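/- Nonexistence of odd stationary profiles at positive overlap (the key step in the proof of Theorem 2.1 of the paper): There is no c with 0 < c ≤ 1 and no odd, twice continuously differentiable function G : ℝ → ℝ with ‖G‖_∞ < ∞, ‖G''‖_∞ < ∞ and 0 ≤ inf G' < sup G' < ∞ such that both E[G(χ)²] = c and ξ''(c) · E[G'(χ)²] ≤ 1 hold, where χ is a centered Gaussian random variable with variance ξ'(c). -/

import Mathlib

open MeasureTheory ProbabilityTheory Real

/-- The mixing function `ξ(x) = ∑_{p ≥ 1} β_p² x^{2p}`. -/
noncomputable def xiFun (β : ℕ → ℝ) (x : ℝ) : ℝ :=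
  ∑' p : ℕ, (β (p + 1)) ^ 2 * x ^ (2 * (p + 1))

/-- First derivative `ξ'(x) = ∑_{p ≥ 1} 2p β_p² x^{2p−1}`. -/
noncomputable def xiD (β : ℕ → ℝ) (x : ℝ) : ℝ :=
  ∑' p : ℕ, (2 * (p + 1) : ℝ) * (β (p + 1)) ^ 2 * x ^ (2 * (p + 1) - 1)

/-- Second derivative `ξ''(x) = ∑_{p ≥ 1} 2p(2p−1) β_p² x^{2p−2}`. -/
noncomputable def xiDD (β : ℕ → ℝ) (x : ℝ) : ℝ :=
  ∑' p : ℕ, (2 * (p + 1) : ℝ) * (2 * (p + 1) - 1 : ℝ) * (β (p + 1)) ^ 2 * x ^ (2 * (p + 1) - 2)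


lemma aux_coef (p : ℕ) : (2 * (p + 1) : ℝ) * (2 * (p + 1) - 1 : ℝ) ≤ 2 * 2 ^ (2 * (p + 1)) := by
  induction p with
  | zero => norm_num
  | succ p ih =>
    have h : (2 : ℝ) ^ (2 * (p + 1 + 1)) = 4 * 2 ^ (2 * (p + 1)) := by ring
    rw [h]
    push_cast
    have hp : (0 : ℝ) ≤ p := Nat.cast_nonneg p
    have h1 : (4 : ℝ) ≤ 2 ^ (2 * (p + 1)) := by
      have h2 : (1 : ℝ) ≤ 2 ^ (2 * p) := one_le_pow₀ (by norm_num)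
      have h3 : (2 : ℝ) ^ (2 * (p + 1)) = 4 * 2 ^ (2 * p) := by ring
      linarith
    nlinarith [sq_nonneg (4 * (p : ℝ) - 1)]

lemma aux_sumDD (β : ℕ → ℝ)
    (hβsum : Summable fun p : ℕ => (2 : ℝ) ^ (2 * (p + 1)) * (β (p + 1)) ^ 2)
    (c : ℝ) (hc : 0 < c) (hc1 : c ≤ 1) :
    Summable fun p : ℕ =>
      (2 * (p + 1) : ℝ) * (2 * (p + 1) - 1 : ℝ) * (β (p + 1)) ^ 2 * c ^ (2 * (p + 1) - 2) := by
  have hn : ∀ p : ℕ, 0 ≤ (2 * (p + 1) : ℝ) * (2 * (p + 1) - 1 : ℝ) := fun p => by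
    have hp : (0 : ℝ) ≤ p := Nat.cast_nonneg p
    exact mul_nonneg (by linarith) (by linarith)
  refine Summable.of_nonneg_of_le (fun p => ?_) (fun p => ?_) (hβsum.mul_left 2)
  · exact mul_nonneg (mul_nonneg (hn p) (sq_nonneg _)) (pow_nonneg hc.le _)
  · calc _ ≤ (2 * (p + 1) : ℝ) * (2 * (p + 1) - 1 : ℝ) * (β (p + 1)) ^ 2 * 1 :=
          mul_le_mul_of_nonneg_left (pow_le_one₀ hc.le hc1) (mul_nonneg (hn p) (sq_nonneg _))
      _ ≤ 2 * 2 ^ (2 * (p + 1)) * (β (p + 1)) ^ 2 := by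
          rw [mul_one]
          exact mul_le_mul_of_nonneg_right (aux_coef p) (sq_nonneg _)
      _ = _ := by ring

lemma aux_term (β : ℕ → ℝ) (c : ℝ) (hc : 0 < c) (p : ℕ) :
    0 ≤ (2 * (p + 1) : ℝ) * (β (p + 1)) ^ 2 * c ^ (2 * (p + 1) - 1) ∧
    (2 * (p + 1) : ℝ) * (β (p + 1)) ^ 2 * c ^ (2 * (p + 1) - 1) ≤
      c * ((2 * (p + 1) : ℝ) * (2 * (p + 1) - 1 : ℝ) * (β (p + 1)) ^ 2 * c ^ (2 * (p + 1) - 2)) := by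
  have hp : (0 : ℝ) ≤ p := Nat.cast_nonneg p
  have e1 : 2 * (p + 1) - 1 = 2 * p + 1 := by omega
  have e2 : 2 * (p + 1) - 2 = 2 * p := by omega
  rw [e1, e2]
  have h0 : 0 ≤ (2 * (p + 1) : ℝ) * (β (p + 1)) ^ 2 * c ^ (2 * p + 1) := by positivity
  refine ⟨h0, ?_⟩
  have : c * ((2 * (p + 1) : ℝ) * (2 * (p + 1) - 1 : ℝ) * (β (p + 1)) ^ 2 * c ^ (2 * p))
    = ((2 * (p + 1) : ℝ) * (β (p + 1)) ^ 2 * c ^ (2 * p + 1)) * (2 * p + 1) := by ring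
  rw [this]
  nlinarith

lemma aux_xi (β : ℕ → ℝ)
    (hβsum : Summable fun p : ℕ => (2 : ℝ) ^ (2 * (p + 1)) * (β (p + 1)) ^ 2)
    (hβne : ∃ p : ℕ, 1 ≤ p ∧ β p ≠ 0) (c : ℝ) (hc : 0 < c) (hc1 : c ≤ 1) :
    0 < xiD β c ∧ xiD β c ≤ c * xiDD β c := by
  have hs := (aux_sumDD β hβsum c hc hc1).mul_left c
  have hs1 := Summable.of_nonneg_of_le (fun p => (aux_term β c hc p).1)
    (fun p => (aux_term β c hc p).2) hs
  constructor
  · obtain ⟨p, hp, hb⟩ := hβne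
    obtain ⟨q, rfl⟩ : ∃ q, p = q + 1 := ⟨p - 1, by omega⟩
    exact hs1.tsum_pos (fun p => (aux_term β c hc p).1) q (by positivity)
  · unfold xiD xiDD
    rw [← tsum_mul_left]
    exact hs1.tsum_le_tsum (fun p => (aux_term β c hc p).2) hs

lemma aux_pdf (v : NNReal) (hv : v ≠ 0) (x : ℝ) :
    HasDerivAt (gaussianPDFReal 0 v) (-(x / v) * gaussianPDFReal 0 v x) x := by
  have hv' : (v : ℝ) ≠ 0 := by exact_mod_cast hv
  unfold gaussianPDFReal
  have h1 : HasDerivAt (fun y : ℝ => -(y - 0) ^ 2 / (2 * (v : ℝ))) (-(x / v)) x := by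
    have := (((hasDerivAt_id x).sub_const 0).pow 2).neg.div_const (2 * (v : ℝ))
    refine this.congr_deriv ?_
    simp
    field_simp
  refine (h1.exp.const_mul (√(2 * π * v))⁻¹).congr_deriv ?_
  ring

/-- Strict Gaussian Poincare inequality for functions vanishing at the origin. -/
lemma aux_poincare (v : NNReal) (hv : v ≠ 0) (G : ℝ → ℝ) (hG : ContDiff ℝ 2 G) (h0 : G 0 = 0)
    (A : ℝ) (hA : ∀ x, |G x| ≤ A) (B : ℝ) (hB : ∀ x, |deriv G x| ≤ B)
    (hne : ∃ x y, deriv G x < deriv G y) :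
    ∫ x, (G x) ^ 2 ∂(gaussianReal 0 v) < v * ∫ x, (deriv G x) ^ 2 ∂(gaussianReal 0 v) := by
  have hv' : (0 : ℝ) < v := by exact_mod_cast pos_iff_ne_zero.mpr hv
  have hd : Differentiable ℝ G := hG.differentiable (by norm_num)
  have hcd : Continuous (deriv G) := hG.continuous_deriv (by norm_num)
  set q : ℝ → ℝ := dslope G 0 with hq
  have hqx : ∀ x, x * q x = G x := fun x => by
    have := sub_smul_dslope G 0 x
    simpa [h0] using this
  have hqc : Continuous q := by
    rw [continuous_iff_continuousAt]
    intro x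
    by_cases hx : x = 0
    · subst hx
      exact continuousAt_dslope_same.2 (hd 0)
    · exact (continuousAt_dslope_of_ne hx).2 (hd x).continuousAt
  have hq0 : q 0 = deriv G 0 := dslope_same G 0
  have hqB : ∀ x, |q x| ≤ B := fun x => by
    by_cases hx : x = 0
    · subst hx; rw [hq0]; exact hB 0
    · have := Convex.norm_image_sub_le_of_norm_deriv_le (f := G) (s := Set.univ) (C := B)
        (fun x _ => hd x) (fun x _ => hB x) convex_univ (Set.mem_univ 0) (Set.mem_univ x)
      rw [h0, sub_zero, sub_zero, ← hqx x, norm_mul, mul_comm] at this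
      exact le_of_mul_le_mul_right this (norm_pos_iff.2 hx)
  set φ : ℝ → ℝ := gaussianPDFReal 0 v with hφ
  have hφpos : ∀ x, 0 < φ x := fun x => gaussianPDFReal_pos 0 v x hv
  have hφi : Integrable φ := integrable_gaussianPDFReal 0 v
  have hφc : Continuous φ := continuous_iff_continuousAt.2 fun x => (aux_pdf v hv x).continuousAt
  -- derivative of G q
  have hGq : ∀ x, HasDerivAt (fun y => G y * q y) (2 * q x * deriv G x - q x ^ 2) x := fun x => by
    by_cases hx : x = 0
    · subst hx
      rw [hasDerivAt_iff_tendsto_slope]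
      have ht : Filter.Tendsto (fun y => q y * q y) (nhdsWithin 0 {0}ᶜ) (nhds (q 0 * q 0)) :=
        ((hqc.mul hqc).tendsto 0).mono_left nhdsWithin_le_nhds
      have e : 2 * q 0 * deriv G 0 - q 0 ^ 2 = q 0 * q 0 := by rw [hq0]; ring
      rw [e]
      refine ht.congr' ?_
      filter_upwards [self_mem_nhdsWithin] with y hy
      have hy : y ≠ 0 := hy
      rw [slope_def_field, h0, ← hqx y]
      field_simp
      ring
    · have h1 : HasDerivAt (fun y => G y ^ 2 / y) (2 * q x * deriv G x - q x ^ 2) x := by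
        refine (((hd x).hasDerivAt.pow 2).div (hasDerivAt_id x) hx).congr_deriv ?_
        simp only [Pi.pow_apply, id]
        rw [← hqx x]
        field_simp
        ring
      refine h1.congr_of_eventuallyEq ?_
      filter_upwards [isOpen_ne.mem_nhds hx] with y hy
      have hy : y ≠ 0 := hy
      rw [← hqx y]
      field_simp
  -- integrability of bounded continuous times φ
  have hint : ∀ f : ℝ → ℝ, Continuous f → (∃ C, ∀ x, |f x| ≤ C) → Integrable (fun x => φ x * f x) := by
    rintro f hf ⟨C, hC⟩
    exact hφi.mul_bdd (c := C) hf.aestronglyMeasurable (Filter.Eventually.of_forall hC)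
  have hA0 : 0 ≤ A := (abs_nonneg _).trans (hA 0)
  have hB0 : 0 ≤ B := (abs_nonneg _).trans (hB 0)
  have iG := hint (fun x => G x ^ 2) (hd.continuous.pow 2) ⟨A ^ 2, fun x => by
    rw [abs_pow]; exact pow_le_pow_left₀ (abs_nonneg _) (hA x) 2⟩
  have iD := hint (fun x => deriv G x ^ 2) (hcd.pow 2) ⟨B ^ 2, fun x => by
    rw [abs_pow]; exact pow_le_pow_left₀ (abs_nonneg _) (hB x) 2⟩
  have iE := hint (fun x => (deriv G x - q x) ^ 2) ((hcd.sub hqc).pow 2) ⟨(B + B) ^ 2, fun x => by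
    rw [abs_pow]
    exact pow_le_pow_left₀ (abs_nonneg _) ((abs_sub _ _).trans (add_le_add (hB x) (hqB x))) 2⟩
  have iF := hint (fun x => G x * q x) (hd.continuous.mul hqc) ⟨A * B, fun x => by
    rw [abs_mul]; exact mul_le_mul (hA x) (hqB x) (abs_nonneg _) hA0⟩
  have hF : ∀ x, HasDerivAt (fun y => φ y * (G y * q y))
      (φ x * deriv G x ^ 2 - (v : ℝ)⁻¹ * (φ x * G x ^ 2) - φ x * (deriv G x - q x) ^ 2) x := fun x => by
    refine ((aux_pdf v hv x).mul (hGq x)).congr_deriv ?_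
    rw [← hφ, ← hqx x]
    field_simp
    ring
  have key := integral_eq_zero_of_hasDerivAt_of_integrable hF
    ((iD.sub (iG.const_mul _)).sub iE) iF
  have k2 : (∫ x, φ x * deriv G x ^ 2) - (v : ℝ)⁻¹ * (∫ x, φ x * G x ^ 2)
      - ∫ x, φ x * (deriv G x - q x) ^ 2 = 0 := by
    have e1 := integral_sub (iD.sub (iG.const_mul (v : ℝ)⁻¹)) iE
    have e2 := integral_sub iD (iG.const_mul (v : ℝ)⁻¹)
    simp only [Pi.sub_apply] at e1
    rw [← key, e1, e2, integral_const_mul]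
  have hpos : 0 < ∫ x, φ x * (deriv G x - q x) ^ 2 := by
    have hnn : ∀ x, 0 ≤ φ x * (deriv G x - q x) ^ 2 :=
      fun x => mul_nonneg (hφpos x).le (sq_nonneg _)
    refine lt_of_le_of_ne (integral_nonneg hnn) fun hz => ?_
    have hae := (integral_eq_zero_iff_of_nonneg hnn iE).1 hz.symm
    have hfe := (Continuous.ae_eq_iff_eq volume (hφc.mul ((hcd.sub hqc).pow 2))
      continuous_zero).1 hae
    have hdq : ∀ x, deriv G x = q x := fun x => by
      have : φ x * (deriv G x - q x) ^ 2 = 0 := congrFun hfe x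
      simp only [mul_eq_zero, (hφpos x).ne', false_or] at this
      exact sub_eq_zero.1 (pow_eq_zero_iff (two_ne_zero) |>.1 this)
    have hdd : Differentiable ℝ (deriv G) := by
      have : ContDiff ℝ 1 (deriv G) := (contDiff_succ_iff_deriv (n := 1)).1 hG |>.2.2
      exact this.differentiable (by norm_num)
    have hddc : Continuous (deriv (deriv G)) := by
      have : ContDiff ℝ 1 (deriv G) := (contDiff_succ_iff_deriv (n := 1)).1 hG |>.2.2
      exact this.continuous_deriv (by norm_num)
    have hz : ∀ x, x * deriv (deriv G) x = 0 := fun x => by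
      have h1 : HasDerivAt G (1 * deriv G x + x * deriv (deriv G) x) x := by
        have := (hasDerivAt_id x).mul (hdd x).hasDerivAt
        refine this.congr_of_eventuallyEq (Filter.Eventually.of_forall fun y => ?_)
        simp [hdq y, hqx y]
      have := h1.unique (hd x).hasDerivAt
      linarith
    have hz2 : deriv (deriv G) = fun _ => 0 := by
      refine Continuous.ext_on (dense_compl_singleton (0 : ℝ)) hddc continuous_const fun x hx => ?_
      exact (mul_eq_zero.1 (hz x)).resolve_left hx
    obtain ⟨x, y, hxy⟩ := hne
    exact hxy.ne (is_const_of_deriv_eq_zero hdd (fun x => congrFun hz2 x) x y)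
  rw [integral_gaussianReal_eq_integral_smul hv, integral_gaussianReal_eq_integral_smul hv]
  simp only [smul_eq_mul]
  change (∫ x, φ x * G x ^ 2) < v * ∫ x, φ x * deriv G x ^ 2
  have k3 : (v : ℝ)⁻¹ * (∫ x, φ x * G x ^ 2) < ∫ x, φ x * deriv G x ^ 2 := by linarith
  rwa [inv_mul_lt_iff₀ hv'] at k3

theorem no_odd_stationary_profile
    (β : ℕ → ℝ)
    (hβsum : Summable fun p : ℕ => (2 : ℝ) ^ (2 * (p + 1)) * (β (p + 1)) ^ 2)
    (hβne : ∃ p : ℕ, 1 ≤ p ∧ β p ≠ 0) :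
    ¬ ∃ (c : ℝ) (G : ℝ → ℝ), 0 < c ∧ c ≤ 1 ∧
      (∀ x, G (-x) = -G x) ∧
      ContDiff ℝ 2 G ∧
      (∃ C, ∀ x, |G x| ≤ C) ∧
      (∃ C, ∀ x, |iteratedDeriv 2 G x| ≤ C) ∧
      (∀ x, 0 ≤ deriv G x) ∧
      (∃ x y, deriv G x < deriv G y) ∧
      (∃ C, ∀ x, deriv G x ≤ C) ∧
      (∫ x, (G x) ^ 2 ∂(gaussianReal 0 (Real.toNNReal (xiD β c))) = c) ∧
      (xiDD β c * ∫ x, (deriv G x) ^ 2 ∂(gaussianReal 0 (Real.toNNReal (xiD β c))) ≤ 1) := by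
  rintro ⟨c, G, hc, hc1, hodd, hG, ⟨A, hA⟩, -, hnn, hne, ⟨B, hB⟩, hE, hD⟩
  obtain ⟨hpos, hle⟩ := aux_xi β hβsum hβne c hc hc1
  have h0 : G 0 = 0 := by
    have := hodd 0
    rw [neg_zero] at this
    linarith
  have hv : Real.toNNReal (xiD β c) ≠ 0 := (Real.toNNReal_pos.2 hpos).ne'
  have h := aux_poincare _ hv G hG h0 A hA B
    (fun x => by rw [abs_of_nonneg (hnn x)]; exact hB x) hne
  rw [hE, Real.coe_toNNReal _ hpos.le] at h
  have hI : 0 ≤ ∫ x, (deriv G x) ^ 2 ∂(gaussianReal 0 (Real.toNNReal (xiD β c))) :=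
    integral_nonneg fun x => sq_nonneg _
  have h1 := mul_le_mul_of_nonneg_right hle hI
  have h2 := mul_le_mul_of_nonneg_left hD hc.le
  rw [← mul_assoc, mul_one] at h2
  linarith
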